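/- Complete monotonicity (Pollard's theorem): let a be a real number with 0 < a ≤ 1. Then the real function x ↦ E_a(−x) is completely monotone on (0, ∞); that is, for every natural number n and every real x > 0, (−1)^n · (d^n/dx^n) E_a(−x) ≥ 0. -/

import Mathlib

/-- The (real) Mittag-Leffler function `E_{a,b}(x) = ∑_{k=0}^∞ x^k / Γ(b + a k)` for real
parameters and real argument; `E_a(x) := E_{a,1}(x)`. -/
noncomputable def mittagLefflerReal (a b x : ℝ) : ℝ :=
  ∑' k : ℕ, x ^ k / Real.Gamma (b + a * k)

open Filter Topology

namespace PollardML

/-- Exponential generating function at `-x`. -/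
noncomputable def F (c : ℕ → ℝ) (x : ℝ) : ℝ := ∑' n : ℕ, (-x) ^ n / (n.factorial : ℝ) * c n

/-- The generating function is entire. -/
def S (c : ℕ → ℝ) : Prop := ∀ B : ℝ, 0 ≤ B → Summable fun n : ℕ => B ^ n / (n.factorial : ℝ) * |c n|

lemma S.norm_summable {c : ℕ → ℝ} (h : S c) (x : ℝ) :
    Summable fun n : ℕ => (-x) ^ n / (n.factorial : ℝ) * c n := by
  refine Summable.of_norm_bounded (h |x| (abs_nonneg x)) fun n => ?_
  simp

lemma S.shift {c : ℕ → ℝ} (h : S c) : S fun n => c (n + 1) := by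
  intro B hB
  have h1 := (summable_nat_add_iff 1).2 (h (2 * (B + 1)) (by positivity))
  refine Summable.of_nonneg_of_le (fun n => by positivity) (fun n => ?_) h1
  have hle : B ^ n / (n.factorial : ℝ) ≤ (2 * (B + 1)) ^ (n + 1) / ((n + 1).factorial : ℝ) := by
    have hf : (0 : ℝ) < n.factorial := by positivity
    rw [Nat.factorial_succ, div_le_div_iff₀ hf (by positivity)]
    have h2 : ((n + 1 : ℕ) : ℝ) ≤ 2 ^ (n + 1) := by exact_mod_cast (Nat.lt_two_pow_self).le
    have h3 : B ^ n ≤ (B + 1) ^ (n + 1) :=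
      (pow_le_pow_left₀ hB (by linarith) n).trans
        (pow_le_pow_right₀ (by linarith) (Nat.le_succ n))
    have h4 : B ^ n * ((n + 1 : ℕ) : ℝ) ≤ (B + 1) ^ (n + 1) * 2 ^ (n + 1) :=
      mul_le_mul h3 h2 (by positivity) (by positivity)
    rw [mul_pow]
    push_cast at h4 ⊢
    nlinarith
  exact mul_le_mul_of_nonneg_right hle (abs_nonneg _)

lemma S.shifts {c : ℕ → ℝ} (h : S c) (m : ℕ) : S fun n => c (n + m) := by
  induction m with
  | zero => simpa using h
  | succ m ih =>
    have := ih.shift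
    simpa [add_assoc, add_comm, add_left_comm] using this

lemma S.mul_bdd {c d : ℕ → ℝ} (h : S c) (hd : ∀ n, |d n| ≤ 1) : S fun n => c n * d n := by
  intro B hB
  refine Summable.of_nonneg_of_le (fun n => by positivity) (fun n => ?_) (h B hB)
  rw [abs_mul]
  exact mul_le_mul_of_nonneg_left (mul_le_of_le_one_right (abs_nonneg _) (hd n)) (by positivity)

lemma S.scale {c : ℕ → ℝ} (h : S c) {r : ℝ} (hr : 0 ≤ r) : S fun n => r ^ n * c n := by
  intro B hB
  refine (h (B * r) (by positivity)).congr fun n => ?_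
  rw [abs_mul, abs_of_nonneg (pow_nonneg hr n), mul_pow]; ring

lemma hasDerivAt_F {c : ℕ → ℝ} (h : S c) (x : ℝ) :
    HasDerivAt (F c) (-(F (fun n => c (n + 1)) x)) x := by
  have hmem : x ∈ Metric.ball (0 : ℝ) (|x| + 1) := by
    rw [Metric.mem_ball, Real.dist_eq, sub_zero]; linarith
  have key : HasDerivAt (fun z => ∑' n : ℕ, (-z) ^ n / (n.factorial : ℝ) * c n)
      (∑' n : ℕ, ((n : ℝ) * (-x) ^ (n - 1) * (-1)) / (n.factorial : ℝ) * c n) x := by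
    refine hasDerivAt_tsum_of_isPreconnected (t := Metric.ball (0 : ℝ) (|x| + 1))
      (u := fun n : ℕ => ((n : ℝ) * (|x| + 1) ^ (n - 1)) / (n.factorial : ℝ) * |c n|)
      (g := fun (n : ℕ) (z : ℝ) => (-z) ^ n / (n.factorial : ℝ) * c n)
      (g' := fun (n : ℕ) (z : ℝ) => ((n : ℝ) * (-z) ^ (n - 1) * (-1)) / (n.factorial : ℝ) * c n)
      (y₀ := x) (y := x)
      ?_ Metric.isOpen_ball (convex_ball _ _).isPreconnected ?_ ?_ hmem (h.norm_summable x) hmem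
    · rw [← summable_nat_add_iff 1]
      refine (h.shift (|x| + 1) (by positivity)).congr fun n => ?_
      rw [Nat.factorial_succ]
      push_cast
      have : (n : ℝ) + 1 ≠ 0 := by positivity
      field_simp
    · intro n y _
      have h1 : HasDerivAt (fun z : ℝ => (-z) ^ n) ((n : ℝ) * (-y) ^ (n - 1) * (-1)) y :=
        (hasDerivAt_id y).neg.pow n
      exact (h1.div_const _).mul_const _
    · intro n y hy
      have hy' : |y| ≤ |x| + 1 := by
        have := Metric.mem_ball.1 hy
        rw [Real.dist_eq, sub_zero] at this
        exact this.le
      simp only [norm_mul, norm_div, norm_pow, norm_neg, Real.norm_eq_abs, abs_one, mul_one,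
        Nat.abs_cast]
      gcongr
  have e : (∑' n : ℕ, ((n : ℝ) * (-x) ^ (n - 1) * (-1)) / (n.factorial : ℝ) * c n)
      = -(F (fun n => c (n + 1)) x) := by
    have e0 : ∀ n : ℕ, (((n + 1 : ℕ) : ℝ) * (-x) ^ (n + 1 - 1) * (-1)) / ((n + 1).factorial : ℝ)
        * c (n + 1) = -((-x) ^ n / (n.factorial : ℝ) * c (n + 1)) := by
      intro n
      rw [Nat.factorial_succ]
      push_cast
      have : (n : ℝ) + 1 ≠ 0 := by positivity
      field_simp
    have hs : Summable fun n : ℕ =>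
        ((n : ℝ) * (-x) ^ (n - 1) * (-1)) / (n.factorial : ℝ) * c n := by
      rw [← summable_nat_add_iff 1]
      exact (h.shift.norm_summable x).neg.congr fun n => (e0 n).symm
    rw [hs.tsum_eq_zero_add]
    simp only [e0]
    rw [tsum_neg]
    simp [F]
  rw [e] at key
  exact key

lemma iteratedDeriv_F (n : ℕ) : ∀ {c : ℕ → ℝ}, S c →
    iteratedDeriv n (F c) = fun x => (-1) ^ n * F (fun j => c (j + n)) x := by
  induction n with
  | zero => intro c _; simp
  | succ n ih =>
    intro c h
    rw [iteratedDeriv_succ, ih h]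
    funext x
    have := ((hasDerivAt_F (h.shifts n) x).const_mul ((-1 : ℝ) ^ n)).deriv
    rw [this, pow_succ]
    have e : (fun j => c (j + 1 + n)) = fun j => c (j + (n + 1)) := by
      funext j; congr 1; ring
    rw [e]; ring

/-- Coefficient form of complete monotonicity. -/
def CM (c : ℕ → ℝ) : Prop := ∀ (n : ℕ) (x : ℝ), 0 ≤ x → 0 ≤ F (fun j => c (j + n)) x

lemma ode {c : ℕ → ℝ} (h : S c) (x : ℝ) :
    x * (-(F (fun n => c (n + 1)) x)) = F (fun n => (n : ℝ) * c n) x := by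
  have e0 : ∀ n : ℕ, (-x) ^ (n + 1) / ((n + 1).factorial : ℝ) * (((n + 1 : ℕ) : ℝ) * c (n + 1))
      = (-x) * ((-x) ^ n / (n.factorial : ℝ) * c (n + 1)) := by
    intro n
    rw [Nat.factorial_succ]
    push_cast
    have : (n : ℝ) + 1 ≠ 0 := by positivity
    field_simp
    ring
  have hs : Summable fun n : ℕ => (-x) ^ n / (n.factorial : ℝ) * ((n : ℝ) * c n) := by
    rw [← summable_nat_add_iff 1]
    exact ((h.shift.norm_summable x).mul_left (-x)).congr fun n => (e0 n).symm
  unfold F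
  rw [hs.tsum_eq_zero_add]
  simp only [e0]
  rw [tsum_mul_left]
  simp

lemma summable_n {c : ℕ → ℝ} (h : S c) (x : ℝ) :
    Summable fun n : ℕ => (-x) ^ n / (n.factorial : ℝ) * ((n : ℝ) * c n) := by
  rw [← summable_nat_add_iff 1]
  refine ((h.shift.norm_summable x).mul_left (-x)).congr fun n => ?_
  rw [Nat.factorial_succ]
  push_cast
  have : (n : ℝ) + 1 ≠ 0 := by positivity
  field_simp
  ring

lemma avg_abs (k n : ℕ) : |((k : ℝ) + 1) / (k + 1 + n)| ≤ 1 := by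
  rw [abs_of_nonneg (by positivity)]
  exact div_le_one_of_le₀ (by linarith [(Nat.cast_nonneg n : (0 : ℝ) ≤ n)]) (by positivity)

lemma CM.avg {c : ℕ → ℝ} (hS : S c) (h : CM c) (k : ℕ) :
    CM fun n => c n * (((k : ℝ) + 1) / (k + 1 + n)) := by
  intro n x hx
  set d : ℕ → ℝ := fun j => c (j + n) * (((k : ℝ) + 1) / (k + 1 + (j + n : ℕ))) with hd
  have hSd : S d := (hS.mul_bdd (avg_abs k)).shifts n
  have hder : ∀ y, HasDerivAt (fun y => y ^ (k + 1 + n) * F d y)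
      (y ^ (k + n) * (((k : ℝ) + 1) * F (fun j => c (j + n)) y)) y := by
    intro y
    have h1 := (hasDerivAt_pow (k + 1 + n) y).mul (hasDerivAt_F hSd y)
    refine h1.congr_deriv ?_
    have e2 : ((k : ℝ) + 1 + n) * F d y + F (fun j => (j : ℝ) * d j) y
        = ((k : ℝ) + 1) * F (fun j => c (j + n)) y := by
      unfold F
      rw [← tsum_mul_left, ← tsum_mul_left,
        ← ((hSd.norm_summable y).mul_left _).tsum_add (summable_n hSd y)]
      refine tsum_congr fun j => ?_
      simp only [hd]
      push_cast
      have : (k : ℝ) + 1 + (j + n) ≠ 0 := by positivity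
      field_simp
      ring
    have e3 := ode hSd y
    have e4 : k + 1 + n = (k + n) + 1 := by ring
    rw [← e2, ← e3, e4, Nat.add_sub_cancel, pow_succ]
    push_cast
    ring
  have hmono : MonotoneOn (fun y => y ^ (k + 1 + n) * F d y) (Set.Ici 0) := by
    refine monotoneOn_of_deriv_nonneg (convex_Ici 0)
      (fun y _ => (hder y).continuousAt.continuousWithinAt)
      (fun y _ => (hder y).differentiableAt.differentiableWithinAt) fun y hy => ?_
    rw [(hder y).deriv]
    have hy0 : 0 ≤ y := by
      rw [interior_Ici] at hy; exact (Set.mem_Ioi.1 hy).le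
    have := h n y hy0
    positivity
  have hpos : ∀ y, 0 < y → 0 ≤ F d y := by
    intro y hy
    have h0 := hmono (Set.mem_Ici.2 le_rfl) (Set.mem_Ici.2 hy.le) hy.le
    have e : (0 : ℝ) ^ (k + 1 + n) = 0 := zero_pow (by omega)
    simp only [e, zero_mul] at h0
    exact nonneg_of_mul_nonneg_right h0 (by positivity)
  have hcont : Tendsto (F d) (𝓝[>] x) (𝓝 (F d x)) :=
    (hasDerivAt_F hSd x).continuousAt.continuousWithinAt
  refine ge_of_tendsto hcont ?_
  filter_upwards [self_mem_nhdsWithin] with y hy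
  exact hpos y (lt_of_le_of_lt hx hy)

/-- The unscaled approximants. -/
noncomputable def q (a : ℝ) (N n : ℕ) : ℝ :=
  ∏ k ∈ Finset.range N, ((k : ℝ) + 1 + a * n) / (k + 1 + n)

lemma fac_split (a : ℝ) (k n : ℕ) : ((k : ℝ) + 1 + a * n) / (k + 1 + n)
    = a + (1 - a) * (((k : ℝ) + 1) / (k + 1 + n)) := by
  have : (k : ℝ) + 1 + n ≠ 0 := by positivity
  field_simp
  ring

lemma q_good {a : ℝ} (ha0 : 0 < a) (ha1 : a ≤ 1) (N : ℕ) : S (q a N) ∧ CM (q a N) := by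
  induction N with
  | zero =>
    constructor
    · intro B _
      simpa [q] using Real.summable_pow_div_factorial B
    · intro n x _
      have : F (fun j => q a 0 (j + n)) x = Real.exp (-x) := by
        rw [Real.exp_eq_exp_ℝ, NormedSpace.exp_eq_tsum_div]
        simp [F, q]
      rw [this]; positivity
  | succ N ih =>
    obtain ⟨hS, hC⟩ := ih
    have e : ∀ n, q a (N + 1) n = q a N n * (((N : ℝ) + 1 + a * n) / (N + 1 + n)) := by
      intro n; rw [q, Finset.prod_range_succ, q]
    constructor
    · have := hS.mul_bdd (d := fun n : ℕ => ((N : ℝ) + 1 + a * n) / (N + 1 + n)) (by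
        intro n
        rw [abs_of_nonneg (by positivity)]
        refine div_le_one_of_le₀ ?_ (by positivity)
        nlinarith [(Nat.cast_nonneg n : (0 : ℝ) ≤ n)])
      rwa [← funext e] at this
    · intro n x hx
      have h1 := hC n x hx
      have h2 := hC.avg hS N n x hx
      have s1 := (hS.shifts n).norm_summable x
      have s2 := ((hS.mul_bdd (avg_abs N)).shifts n).norm_summable x
      have : F (fun j => q a (N + 1) (j + n)) x = a * F (fun j => q a N (j + n)) x
          + (1 - a) * F (fun j => q a N (j + n) * (((N : ℝ) + 1) / (N + 1 + (j + n : ℕ)))) x := by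
        unfold F
        rw [← tsum_mul_left, ← tsum_mul_left, ← (s1.mul_left a).tsum_add (s2.mul_left (1 - a))]
        refine tsum_congr fun j => ?_
        simp only [e, fac_split]; ring
      rw [this]
      have : 0 ≤ 1 - a := by linarith
      positivity

/-- The scaled approximants. -/
noncomputable def p (a : ℝ) (N n : ℕ) : ℝ := (((N : ℝ) + 1) ^ (1 - a)) ^ n * q a N n

lemma p_good {a : ℝ} (ha0 : 0 < a) (ha1 : a ≤ 1) (N : ℕ) : S (p a N) ∧ CM (p a N) := by
  obtain ⟨hS, hC⟩ := q_good ha0 ha1 N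
  have hr : 0 ≤ ((N : ℝ) + 1) ^ (1 - a) := by positivity
  refine ⟨hS.scale hr, fun n x hx => ?_⟩
  have : F (fun j => p a N (j + n)) x = (((N : ℝ) + 1) ^ (1 - a)) ^ n *
      F (fun j => q a N (j + n)) ((((N : ℝ) + 1) ^ (1 - a)) * x) := by
    unfold F
    rw [← tsum_mul_left]
    refine tsum_congr fun j => ?_
    simp only [p]
    rw [pow_add, show -((((N : ℝ) + 1) ^ (1 - a)) * x) = (((N : ℝ) + 1) ^ (1 - a)) * (-x) by ring,
      mul_pow]
    ring
  rw [this]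
  exact mul_nonneg (by positivity) (hC n _ (by positivity))

lemma p_nonneg {a : ℝ} (ha0 : 0 < a) (N n : ℕ) : 0 ≤ p a N n := by
  unfold p q
  refine mul_nonneg (by positivity) (Finset.prod_nonneg fun k _ => by positivity)

lemma p_mono {a : ℝ} (ha0 : 0 < a) (ha1 : a ≤ 1) (n : ℕ) : Monotone fun N => p a N n := by
  refine monotone_nat_of_le_succ fun N => ?_
  have hN : (0 : ℝ) < (N : ℝ) + 1 := by positivity
  have hn : (0 : ℝ) ≤ n := Nat.cast_nonneg n
  have hq : 0 ≤ q a N n := Finset.prod_nonneg fun k _ => by positivity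
  have key : (((N : ℝ) + 1) ^ (1 - a)) ^ n ≤
      ((((N + 1 : ℕ) : ℝ) + 1) ^ (1 - a)) ^ n * (((N : ℝ) + 1 + a * n) / (N + 1 + n)) := by
    have amgm := Real.geom_mean_le_arith_mean2_weighted (w₁ := 1 - a) (w₂ := a)
      (p₁ := (N : ℝ) + 1) (p₂ := (N : ℝ) + 1 + n) (by linarith) ha0.le hN.le (by positivity)
      (by ring)
    have e1 : (1 - a) * ((N : ℝ) + 1) + a * (N + 1 + n) = N + 1 + a * n := by ring
    rw [e1] at amgm
    have hb : ((N : ℝ) + 1) ^ n * (N + 1 + n) ≤ ((N : ℝ) + 1 + 1) ^ n * (N + 1) := by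
      have b := one_add_mul_le_pow (a := 1 / ((N : ℝ) + 1)) (by
        have : (0 : ℝ) ≤ 1 / ((N : ℝ) + 1) := by positivity
        linarith) n
      have e2 : ((N : ℝ) + 1 + 1) ^ n = (N + 1) ^ n * (1 + 1 / ((N : ℝ) + 1)) ^ n := by
        rw [← mul_pow]; congr 1; field_simp
      have e3 : (N : ℝ) + 1 + n = (1 + n * (1 / ((N : ℝ) + 1))) * (N + 1) := by field_simp
      rw [e2, e3, mul_assoc]
      gcongr
    have hb2 : (((N : ℝ) + 1) ^ (1 - a)) ^ n * ((N : ℝ) + 1 + n) ^ (1 - a) ≤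
        (((N : ℝ) + 1 + 1) ^ (1 - a)) ^ n * ((N : ℝ) + 1) ^ (1 - a) := by
      have := Real.rpow_le_rpow (by positivity) hb (by linarith : 0 ≤ 1 - a)
      rw [Real.mul_rpow (by positivity) (by positivity),
        Real.mul_rpow (by positivity) (by positivity)] at this
      rw [Real.rpow_pow_comm hN.le, Real.rpow_pow_comm (by positivity)]
      exact this
    rw [mul_div_assoc', le_div_iff₀ (by positivity)]
    push_cast
    calc (((N : ℝ) + 1) ^ (1 - a)) ^ n * (N + 1 + n)
        = (((N : ℝ) + 1) ^ (1 - a)) ^ n * ((N : ℝ) + 1 + n) ^ (1 - a) * ((N : ℝ) + 1 + n) ^ a := by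
          rw [mul_assoc, ← Real.rpow_add (by positivity)]
          simp
      _ ≤ (((N : ℝ) + 1 + 1) ^ (1 - a)) ^ n * ((N : ℝ) + 1) ^ (1 - a) * ((N : ℝ) + 1 + n) ^ a := by
          gcongr
      _ ≤ _ := by
          rw [mul_assoc]
          gcongr
  have e : q a (N + 1) n = q a N n * (((N : ℝ) + 1 + a * n) / (N + 1 + n)) := by
    rw [q, Finset.prod_range_succ, q]
  simp only [p]
  rw [e]
  calc _ ≤ (((((N + 1 : ℕ) : ℝ) + 1) ^ (1 - a)) ^ n * (((N : ℝ) + 1 + a * n) / (N + 1 + n)))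
        * q a N n := mul_le_mul_of_nonneg_right key hq
    _ = _ := by ring

/-- The limiting moments. -/
noncomputable def L (a : ℝ) (n : ℕ) : ℝ := (n.factorial : ℝ) / Real.Gamma (1 + a * n)

lemma p_tendsto {a : ℝ} (ha0 : 0 < a) (n : ℕ) :
    Tendsto (fun N => p a N n) atTop (𝓝 (L a n)) := by
  rw [← tendsto_add_atTop_iff_nat 1]
  have hG : Real.Gamma (1 + a * n) ≠ 0 := (Real.Gamma_pos_of_pos (by positivity)).ne'
  have h1 := (Real.GammaSeq_tendsto_Gamma (1 + n)).div (Real.GammaSeq_tendsto_Gamma (1 + a * n)) hG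
  have h2 : Tendsto (fun N : ℕ => ((((N : ℝ) + 2) / N) ^ (1 - a)) ^ n) atTop (𝓝 1) := by
    have h3 : Tendsto (fun N : ℕ => ((N : ℝ) + 2) / N) atTop (𝓝 1) := by
      have h4 := (tendsto_const_div_atTop_nhds_zero_nat (2 : ℝ)).const_add 1
      rw [add_zero] at h4
      refine h4.congr' ?_
      filter_upwards [eventually_gt_atTop 0] with N hN
      have : (N : ℝ) ≠ 0 := by positivity
      field_simp
    have h5 := (h3.rpow_const (p := 1 - a) (Or.inl one_ne_zero)).pow n
    simpa using h5
  have h6 := h1.mul h2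
  have e : Real.Gamma (1 + n) / Real.Gamma (1 + a * n) * 1 = L a n := by
    rw [L, mul_one, add_comm, Real.Gamma_nat_eq_factorial]
  rw [e] at h6
  refine h6.congr' ?_
  filter_upwards [eventually_gt_atTop 0] with N hN
  have hN' : (0 : ℝ) < N := by positivity
  have hq : q a (N + 1) n = (∏ j ∈ Finset.range (N + 1), (1 + a * n + (j : ℝ))) /
      ∏ j ∈ Finset.range (N + 1), ((1 : ℝ) + n + j) := by
    rw [q, ← Finset.prod_div_distrib]
    refine Finset.prod_congr rfl fun j _ => ?_
    congr 1 <;> ring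
  have hp1 : (∏ j ∈ Finset.range (N + 1), (1 + a * n + (j : ℝ))) ≠ 0 :=
    Finset.prod_ne_zero_iff.2 fun j _ => by positivity
  have hp2 : (∏ j ∈ Finset.range (N + 1), ((1 : ℝ) + n + j)) ≠ 0 :=
    Finset.prod_ne_zero_iff.2 fun j _ => by positivity
  have hf : (N.factorial : ℝ) ≠ 0 := by positivity
  have hpow : (N : ℝ) ^ (1 + (n : ℝ)) = (N : ℝ) ^ (1 + a * n) * ((N : ℝ) ^ (1 - a)) ^ n := by
    rw [← Real.rpow_natCast, ← Real.rpow_mul hN'.le, ← Real.rpow_add hN']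
    congr 1; ring
  have hne : (N : ℝ) ^ (1 + a * n) ≠ 0 := (Real.rpow_pos_of_pos hN' _).ne'
  have hne2 : (N : ℝ) ^ (1 - a) ≠ 0 := (Real.rpow_pos_of_pos hN' _).ne'
  simp only [p, Pi.div_apply]
  rw [hq, Real.GammaSeq, Real.GammaSeq, hpow, Real.div_rpow (by positivity) hN'.le]
  push_cast
  rw [show (N : ℝ) + 1 + 1 = N + 2 by ring, div_pow]
  field_simp

lemma Gamma_ratio {a y : ℝ} (ha0 : 0 < a) (hy : 1 < y) :
    (y - 1) ^ a * Real.Gamma y ≤ Real.Gamma (y + a) := by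
  have hc := Real.convexOn_log_Gamma
  have hs := hc.slope_mono_adjacent (x := y - 1) (y := y) (z := y + a)
    (Set.mem_Ioi.2 (by linarith)) (Set.mem_Ioi.2 (by linarith)) (by linarith) (by linarith)
  have g1 : 0 < Real.Gamma (y - 1) := Real.Gamma_pos_of_pos (by linarith)
  have g2 : 0 < Real.Gamma y := Real.Gamma_pos_of_pos (by linarith)
  have g3 : 0 < Real.Gamma (y + a) := Real.Gamma_pos_of_pos (by linarith)
  have e : Real.Gamma y = (y - 1) * Real.Gamma (y - 1) := by
    have := Real.Gamma_add_one (s := y - 1) (by linarith)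
    rwa [sub_add_cancel] at this
  have el : Real.log (Real.Gamma y) = Real.log (y - 1) + Real.log (Real.Gamma (y - 1)) := by
    rw [e, Real.log_mul (by linarith) g1.ne']
  simp only [Function.comp] at hs
  rw [show y - (y - 1) = 1 by ring, show y + a - y = a by ring, div_one, le_div_iff₀ ha0] at hs
  have hy1 : 0 < y - 1 := by linarith
  rw [← Real.log_le_log_iff (by positivity) g3, Real.log_mul (by positivity) g2.ne',
    Real.log_rpow hy1]
  nlinarith

lemma L_S {a : ℝ} (ha0 : 0 < a) : S (L a) := by
  intro B hB
  have hpos : ∀ n : ℕ, 0 < Real.Gamma (1 + a * n) := fun n => Real.Gamma_pos_of_pos (by positivity)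
  have e : (fun n : ℕ => B ^ n / (n.factorial : ℝ) * |L a n|)
      = fun n : ℕ => B ^ n / Real.Gamma (1 + a * n) := by
    funext n
    have := hpos n
    have hf : (n.factorial : ℝ) ≠ 0 := by positivity
    rw [L, abs_of_nonneg (by positivity)]
    field_simp
  rw [e]
  rcases hB.eq_or_lt with rfl | hB
  · refine summable_of_ne_finset_zero (s := {0}) fun n hn => ?_
    rw [zero_pow (by simpa using hn), zero_div]
  refine summable_of_ratio_test_tendsto_lt_one (l := 0) one_pos
    (Eventually.of_forall fun n => ?_) ?_
  · have := hpos n; positivity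
  have hlim : Tendsto (fun n : ℕ => B / (a * n) ^ a) atTop (𝓝 0) := by
    refine Tendsto.div_atTop tendsto_const_nhds ?_
    exact (tendsto_rpow_atTop ha0).comp (tendsto_natCast_atTop_atTop.const_mul_atTop ha0)
  refine tendsto_of_tendsto_of_tendsto_of_le_of_le' tendsto_const_nhds hlim
    (Eventually.of_forall fun n => norm_nonneg _ |> fun h => div_nonneg h (norm_nonneg _)) ?_
  filter_upwards [eventually_gt_atTop 0] with n hn
  have hn' : (0 : ℝ) < n := by positivity
  have h1 := hpos n
  have h2 := hpos (n + 1)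
  have hr := Gamma_ratio (a := a) (y := 1 + a * n) ha0 (by nlinarith [mul_pos ha0 hn'])
  rw [show 1 + a * (n : ℝ) - 1 = a * n by ring,
    show 1 + a * (n : ℝ) + a = 1 + a * ((n + 1 : ℕ) : ℝ) by push_cast; ring] at hr
  rw [Real.norm_of_nonneg (by positivity), Real.norm_of_nonneg (by positivity)]
  have hA : 0 < (a * (n : ℝ)) ^ a := by positivity
  rw [div_div_div_eq, div_le_div_iff₀ (by positivity) hA, pow_succ]
  calc B ^ n * B * Real.Gamma (1 + a * n) * (a * (n : ℝ)) ^ a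
      = B ^ n * B * ((a * (n : ℝ)) ^ a * Real.Gamma (1 + a * n)) := by ring
    _ ≤ B ^ n * B * Real.Gamma (1 + a * ((n + 1 : ℕ) : ℝ)) := by gcongr
    _ = _ := by ring

lemma L_CM {a : ℝ} (ha0 : 0 < a) (ha1 : a ≤ 1) : CM (L a) := by
  intro n x hx
  have hle : ∀ N m, p a N m ≤ L a m := fun N m =>
    (p_mono ha0 ha1 m).ge_of_tendsto (p_tendsto ha0 m) N
  have ht : Tendsto (fun N => F (fun j => p a N (j + n)) x) atTop
      (𝓝 (F (fun j => L a (j + n)) x)) := by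
    unfold F
    refine tendsto_tsum_of_dominated_convergence ((L_S ha0).shifts n |x| (abs_nonneg x))
      (fun j => (p_tendsto ha0 (j + n)).const_mul _) (Eventually.of_forall fun N j => ?_)
    have h0 := p_nonneg ha0 N (j + n)
    simp only [norm_mul, norm_div, norm_pow, norm_neg, Real.norm_eq_abs, Nat.abs_cast]
    refine mul_le_mul_of_nonneg_left ?_ (by positivity)
    exact abs_le_abs_of_nonneg h0 (hle N _)
  exact ge_of_tendsto ht (Eventually.of_forall fun N => (p_good ha0 ha1 N).2 n x hx)

end PollardML

/-- Complete monotonicity (Pollard's theorem): for `0 < a ≤ 1`, the function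
`x ↦ E_a(−x)` is completely monotone on `(0, ∞)`:
`(−1)^n (d^n/dx^n) E_a(−x) ≥ 0` for every `n` and every `x > 0`. -/
theorem mittagLeffler_completelyMonotone (a : ℝ) (ha0 : 0 < a) (ha1 : a ≤ 1) :
    ∀ (n : ℕ) (x : ℝ), 0 < x →
      0 ≤ (-1 : ℝ) ^ n * iteratedDeriv n (fun y : ℝ => mittagLefflerReal a 1 (-y)) x := by
  intro n x hx
  have e : (fun y : ℝ => mittagLefflerReal a 1 (-y)) = PollardML.F (PollardML.L a) := by
    funext y
    unfold mittagLefflerReal PollardML.F PollardML.L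
    refine tsum_congr fun k => ?_
    have hf : (k.factorial : ℝ) ≠ 0 := by positivity
    field_simp
  rw [e, PollardML.iteratedDeriv_F n (PollardML.L_S ha0)]
  have h := PollardML.L_CM ha0 ha1 n x hx.le
  have e2 : (-1 : ℝ) ^ n * (-1) ^ n = 1 := by rw [← mul_pow]; simp
  simp only [← mul_assoc, e2, one_mul]
  exact h
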